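/- Let q ≥ 1, p > 0 and γ ∈ W^{1,∞}_{i,a}(𝕋, ℝ^n). Then G^{(p,q)}(γ) ≤ TP^{(p,q)}(γ), with equality if the image of γ is a round circle. -/

import Mathlib

open MeasureTheory Real Set intervalIntegral
open scoped ENNReal RealInnerProductSpace

noncomputable section

/-- A closed `W^{1,1}`-curve on the torus `𝕋 = ℝ/ℤ` with values in `ℝⁿ`, encoded as a
`1`-periodic absolutely continuous function `toFun : ℝ → ℝⁿ` together with its
(weak) derivative `deriv'`. -/
structure ClosedCurve (n : ℕ) where
  toFun : ℝ → EuclideanSpace ℝ (Fin n)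
  deriv' : ℝ → EuclideanSpace ℝ (Fin n)
  periodic : Function.Periodic toFun 1
  deriv'_periodic : Function.Periodic deriv' 1
  integrableOn : MeasureTheory.IntegrableOn deriv' (Set.Icc (0:ℝ) 1)
  eq_integral : ∀ t : ℝ, toFun t = toFun 0 + ∫ s in (0:ℝ)..t, deriv' s

namespace ClosedCurve

variable {n : ℕ}

/-- Injectivity as a map on the torus `ℝ/ℤ`. -/
def IsInj (γ : ClosedCurve n) : Prop :=
  ∀ s t : ℝ, γ.toFun s = γ.toFun t → ∃ k : ℤ, s - t = (k : ℝ)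

/-- Regularity: the derivative does not vanish a.e. -/
def IsRegular (γ : ClosedCurve n) : Prop := ∀ᵐ t : ℝ ∂volume, γ.deriv' t ≠ 0

/-- Parametrization by arc length: `|γ'| = 1` a.e. -/
def IsArclength (γ : ClosedCurve n) : Prop := ∀ᵐ t : ℝ ∂volume, ‖γ.deriv' t‖ = 1

/-- The length of a closed curve. -/
def length (γ : ClosedCurve n) : ℝ := ∫ t in (0:ℝ)..1, ‖γ.deriv' t‖

end ClosedCurve

/-- Orthogonal projection onto the orthogonal complement of `span {v}` (for `v ≠ 0`). -/
def projPerp {F : Type*} [NormedAddCommGroup F] [InnerProductSpace ℝ F] (v x : F) : F :=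
  x - (⟪v, x⟫ / ‖v‖ ^ 2) • v

/-- The Gauss map `φ_γ(u,w)`: the unit secant direction. -/
def gaussMap {n : ℕ} (γ : ClosedCurve n) (u w : ℝ) : EuclideanSpace ℝ (Fin n) :=
  ‖γ.toFun (u + w) - γ.toFun u‖⁻¹ • (γ.toFun (u + w) - γ.toFun u)

/-- `|∂_u φ_γ(u,w)|`, expressed via the identity (1.8) of the paper. -/
def gaussDerivU {n : ℕ} (γ : ClosedCurve n) (u w : ℝ) : ℝ :=
  ‖projPerp (gaussMap γ u w) (γ.deriv' (u + w) - γ.deriv' u)‖ /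
    ‖γ.toFun (u + w) - γ.toFun u‖

/-- `|∂_w φ_γ(u,w)|`, expressed via the identity (1.7) of the paper. -/
def gaussDerivW {n : ℕ} (γ : ClosedCurve n) (u w : ℝ) : ℝ :=
  ‖projPerp (gaussMap γ u w) (γ.deriv' (u + w))‖ / ‖γ.toFun (u + w) - γ.toFun u‖

/-- The generalized tangent-point energy `TP^{(p,q)}` (with values in `[0,∞]`). -/
def TP {n : ℕ} (p q : ℝ) (γ : ClosedCurve n) : ℝ≥0∞ :=
  ∫⁻ u in Set.Ioc (0:ℝ) 1, ∫⁻ w in Set.Ioc (0:ℝ) 1,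
    ENNReal.ofReal
      (‖projPerp (γ.deriv' u) (γ.toFun (u + w) - γ.toFun u)‖ ^ q /
        ‖γ.toFun (u + w) - γ.toFun u‖ ^ p * (‖γ.deriv' u‖ * ‖γ.deriv' (u + w)‖))

/-- The minorant `G^{(p,q)}_w`. -/
def Gw {n : ℕ} (p q : ℝ) (γ : ClosedCurve n) (w : ℝ) : ℝ≥0∞ :=
  ∫⁻ u in Set.Ioc (0:ℝ) 1,
    ENNReal.ofReal ((1/2 * gaussDerivU γ u w) ^ q *
      ‖γ.toFun (u + w) - γ.toFun u‖ ^ (2*q - p))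

/-- The minorant `G^{(p,q)}`. -/
def G {n : ℕ} (p q : ℝ) (γ : ClosedCurve n) : ℝ≥0∞ :=
  ∫⁻ w in Set.Ioc (0:ℝ) 1, Gw p q γ w

/-- A round circle in a euclidean space: a sphere intersected with a 2-dimensional plane
through its center. -/
def IsCircle {F : Type*} [NormedAddCommGroup F] [InnerProductSpace ℝ F] (S : Set F) : Prop :=
  ∃ (c : F) (r : ℝ) (V : Submodule ℝ F), 0 < r ∧ Module.finrank ℝ V = 2 ∧
    S = {x | ‖x - c‖ = r ∧ x - c ∈ V}

/-- A great circle of the unit sphere. -/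
def IsGreatCircle {F : Type*} [NormedAddCommGroup F] [InnerProductSpace ℝ F]
    (S : Set F) : Prop :=
  ∃ V : Submodule ℝ F, Module.finrank ℝ V = 2 ∧ S = {x | ‖x‖ = 1 ∧ x ∈ V}

/-- Half of a great circle of the unit sphere: a great-circle arc of angular length `π`. -/
def IsHalfGreatCircle {F : Type*} [NormedAddCommGroup F] [InnerProductSpace ℝ F]
    (S : Set F) : Prop :=
  ∃ a b : F, ‖a‖ = 1 ∧ ‖b‖ = 1 ∧ ⟪a, b⟫ = 0 ∧
    S = (fun t : ℝ => Real.cos t • a + Real.sin t • b) '' Set.Icc 0 π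

/-- A curve is convex if its image is the boundary (within its affine hull) of a convex
planar (2-dimensional) set. -/
def ClosedCurve.IsConvex {n : ℕ} (γ : ClosedCurve n) : Prop :=
  ∃ K : Set (EuclideanSpace ℝ (Fin n)), Convex ℝ K ∧
    Module.finrank ℝ (affineSpan ℝ K).direction = 2 ∧
    Set.range γ.toFun = intrinsicFrontier ℝ K

section projPerp

variable {F : Type*} [NormedAddCommGroup F] [InnerProductSpace ℝ F]

lemma norm_projPerp_sq (v x : F) :
    ‖projPerp v x‖ ^ 2 = ‖x‖ ^ 2 - ⟪v, x⟫ ^ 2 / ‖v‖ ^ 2 := by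
  rcases eq_or_ne v 0 with rfl | hv
  · simp [projPerp]
  have hv' : ‖v‖ ≠ 0 := norm_ne_zero_iff.2 hv
  rw [projPerp, norm_sub_sq_real, inner_smul_right, norm_smul, real_inner_comm, mul_pow,
    norm_eq_abs, sq_abs]
  field_simp
  ring

lemma projPerp_sub (v x y : F) : projPerp v (x - y) = projPerp v x - projPerp v y := by
  simp only [projPerp, inner_sub_right, sub_div, sub_smul]
  abel

lemma norm_projPerp_neg (v x : F) : ‖projPerp v (-x)‖ = ‖projPerp v x‖ := by
  rw [← norm_neg (projPerp v x)]
  congr 1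
  simp only [projPerp, inner_neg_right, neg_div, neg_smul]
  abel

lemma norm_projPerp_normalize {a x : F} (ha : ‖a‖ = 1) (hx : x ≠ 0) :
    ‖projPerp (‖x‖⁻¹ • x) a‖ = ‖projPerp a x‖ / ‖x‖ := by
  have hx' : ‖x‖ ≠ 0 := norm_ne_zero_iff.2 hx
  rw [← sq_eq_sq₀ (norm_nonneg _) (by positivity), div_pow, norm_projPerp_sq, norm_projPerp_sq,
    norm_smul, norm_inv, norm_norm, inv_mul_cancel₀ hx', real_inner_smul_left, real_inner_comm, ha]
  field_simp

end projPerp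

/-- For unit tangents `a`, `b` at the ends of a chord `x`, the integrand of the minorant is at most
the mean of the two tangent-point integrands. -/
lemma gauss_integrand_le {F : Type*} [NormedAddCommGroup F] [InnerProductSpace ℝ F]
    {p q : ℝ} (hq : 1 ≤ q) {a b x : F} (ha : ‖a‖ = 1) (hb : ‖b‖ = 1) :
    (1 / 2 * (‖projPerp (‖x‖⁻¹ • x) (b - a)‖ / ‖x‖)) ^ q * ‖x‖ ^ (2 * q - p) ≤
      1 / 2 * (‖projPerp a x‖ ^ q / ‖x‖ ^ p) + 1 / 2 * (‖projPerp b x‖ ^ q / ‖x‖ ^ p) := by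
  rcases eq_or_ne x 0 with rfl | hx
  · rw [norm_zero, div_zero, mul_zero, zero_rpow (by positivity), zero_mul]
    positivity
  have hd : 0 < ‖x‖ := norm_pos_iff.2 hx
  set A := ‖projPerp a x‖
  set B := ‖projPerp b x‖
  have hA : 0 ≤ A := norm_nonneg _
  have hB : 0 ≤ B := norm_nonneg _
  have h₁ : ‖projPerp (‖x‖⁻¹ • x) (b - a)‖ ≤ (A + B) / ‖x‖ := by
    rw [projPerp_sub]
    refine (norm_sub_le _ _).trans_eq ?_
    rw [norm_projPerp_normalize ha hx, norm_projPerp_normalize hb hx]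
    ring
  have h₂ : (1 / 2 * A + 1 / 2 * B) ^ q ≤ 1 / 2 * A ^ q + 1 / 2 * B ^ q := by
    have h := (convexOn_rpow hq).2 hA hB (by norm_num : (0 : ℝ) ≤ 1 / 2)
      (by norm_num : (0 : ℝ) ≤ 1 / 2) (by norm_num)
    simpa only [smul_eq_mul] using h
  calc
    _ ≤ (1 / 2 * ((A + B) / ‖x‖ / ‖x‖)) ^ q * ‖x‖ ^ (2 * q - p) := by gcongr
    _ = (1 / 2 * A + 1 / 2 * B) ^ q / ‖x‖ ^ p := by
      have : 1 / 2 * ((A + B) / ‖x‖ / ‖x‖) = (1 / 2 * A + 1 / 2 * B) / ‖x‖ ^ (2 : ℝ) := by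
        rw [rpow_two]; field_simp
      rw [this, div_rpow (by positivity) (by positivity), ← rpow_mul hd.le, rpow_sub hd]
      field_simp
    _ ≤ (1 / 2 * A ^ q + 1 / 2 * B ^ q) / ‖x‖ ^ p := by gcongr
    _ = _ := by ring

/-- If the tangents at the ends of a chord `x` are those of a circle of radius `r`, the integrand
of the minorant equals the tangent-point integrand. -/
lemma gauss_integrand_eq {F : Type*} [NormedAddCommGroup F] [InnerProductSpace ℝ F]
    {p q r : ℝ} (hr : 0 < r) {a b x : F} (hx : x ≠ 0) (ha : ‖a‖ = 1)
    (hperp : ⟪x, b - a⟫ = 0) (hba : ‖b - a‖ = ‖x‖ / r)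
    (hax : ⟪a, x⟫ ^ 2 = ‖x‖ ^ 2 - (‖x‖ ^ 2 / (2 * r)) ^ 2) :
    (1 / 2 * (‖projPerp (‖x‖⁻¹ • x) (b - a)‖ / ‖x‖)) ^ q * ‖x‖ ^ (2 * q - p) =
      ‖projPerp a x‖ ^ q / ‖x‖ ^ p := by
  have hd : 0 < ‖x‖ := norm_pos_iff.2 hx
  have h₁ : projPerp (‖x‖⁻¹ • x) (b - a) = b - a := by
    simp [projPerp, inner_smul_left, hperp]
  have h₂ : ‖projPerp a x‖ = ‖x‖ ^ 2 / (2 * r) := by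
    rw [← sq_eq_sq₀ (norm_nonneg _) (by positivity), norm_projPerp_sq, ha, hax]
    ring
  have h₃ : 1 / 2 * (‖x‖ / r / ‖x‖) = ‖x‖ ^ 2 / (2 * r) / ‖x‖ ^ (2 : ℝ) := by
    rw [rpow_two]; field_simp
  rw [h₁, hba, h₂, h₃, div_rpow (by positivity) (by positivity), ← rpow_mul hd.le, rpow_sub hd]
  field_simp

lemma Function.Periodic.setLIntegral_Ioc_eq {f : ℝ → ℝ≥0∞} {T : ℝ} (hf : Function.Periodic f T)
    (hT : 0 < T) (s t : ℝ) :
    ∫⁻ x in Ioc s (s + T), f x = ∫⁻ x in Ioc t (t + T), f x := by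
  have : VAddInvariantMeasure (AddSubgroup.zmultiples T) ℝ volume :=
    ⟨fun c s _ => measure_preimage_add _ _ _⟩
  apply IsAddFundamentalDomain.setLIntegral_eq (G := AddSubgroup.zmultiples T)
  exacts [isAddFundamentalDomain_Ioc hT s, isAddFundamentalDomain_Ioc hT t,
    hf.map_vadd_zmultiples]

lemma Function.Periodic.setLIntegral_Ioc_comp_add {f : ℝ → ℝ≥0∞} (hf : Function.Periodic f 1)
    (w : ℝ) : ∫⁻ u in Ioc (0 : ℝ) 1, f (u + w) = ∫⁻ u in Ioc (0 : ℝ) 1, f u := by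
  have h := (measurePreserving_add_right (volume : Measure ℝ) w).setLIntegral_comp_preimage_emb
    (measurableEmbedding_addRight w) f (Ioc w (w + 1))
  rw [hf.setLIntegral_Ioc_eq one_pos w 0, zero_add] at h
  rw [← h]
  congr 3
  ext u
  simp [add_comm]

lemma Function.Periodic.setLIntegral_Ioc_comp_neg {f : ℝ → ℝ≥0∞} (hf : Function.Periodic f 1) :
    ∫⁻ u in Ioc (0 : ℝ) 1, f (-u) = ∫⁻ u in Ioc (0 : ℝ) 1, f u := by
  have h := (Measure.measurePreserving_neg (volume : Measure ℝ)).setLIntegral_comp_preimage_emb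
    (MeasurableEquiv.neg ℝ).measurableEmbedding f (Ioc (-1) (-1 + 1))
  rw [hf.setLIntegral_Ioc_eq one_pos (-1) 0, zero_add] at h
  rw [← h, neg_add_cancel, neg_preimage, neg_Ioc, neg_neg, neg_zero]
  exact setLIntegral_congr Ico_ae_eq_Ioc.symm

namespace ClosedCurve

variable {n : ℕ} (γ : ClosedCurve n)

lemma intervalIntegrable_deriv' (a b : ℝ) : IntervalIntegrable γ.deriv' volume a b :=
  γ.deriv'_periodic.intervalIntegrable₀ one_ne_zero
    ((intervalIntegrable_iff_integrableOn_Icc_of_le zero_le_one).2 γ.integrableOn) a b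

lemma locallyIntegrable_deriv' : LocallyIntegrable γ.deriv' := fun x =>
  ⟨Icc (x - 1) (x + 1), Icc_mem_nhds (by linarith) (by linarith),
    (intervalIntegrable_iff_integrableOn_Icc_of_le (by linarith)).1
      (γ.intervalIntegrable_deriv' _ _)⟩

lemma aemeasurable_deriv' : AEMeasurable γ.deriv' :=
  γ.locallyIntegrable_deriv'.aestronglyMeasurable.aemeasurable

lemma ae_hasDerivAt : ∀ᵐ t, HasDerivAt γ.toFun (γ.deriv' t) t := by
  filter_upwards [LocallyIntegrable.ae_hasDerivAt_integral γ.locallyIntegrable_deriv'] with t ht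
  rw [funext γ.eq_integral]
  exact (ht 0).const_add _

lemma continuous_toFun : Continuous γ.toFun := by
  rw [funext γ.eq_integral]
  exact continuous_const.add (continuous_primitive γ.intervalIntegrable_deriv' 0)

/-- The integrand of the tangent-point energy, as a function of the base point and the offset. -/
def tpIntegrand (p q : ℝ) (z : ℝ × ℝ) : ℝ≥0∞ :=
  ENNReal.ofReal
    (‖projPerp (γ.deriv' z.1) (γ.toFun (z.1 + z.2) - γ.toFun z.1)‖ ^ q /
      ‖γ.toFun (z.1 + z.2) - γ.toFun z.1‖ ^ p * (‖γ.deriv' z.1‖ * ‖γ.deriv' (z.1 + z.2)‖))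

lemma tpIntegrand_periodic_fst (p q w : ℝ) :
    Function.Periodic (fun u => γ.tpIntegrand p q (u, w)) 1 := fun u => by
  simp only [tpIntegrand, add_right_comm u 1 w, γ.periodic _, γ.deriv'_periodic _]

lemma tpIntegrand_periodic_snd (p q u : ℝ) :
    Function.Periodic (fun w => γ.tpIntegrand p q (u, w)) 1 := fun w => by
  simp only [tpIntegrand, ← add_assoc, γ.periodic _, γ.deriv'_periodic _]

lemma aemeasurable_tpIntegrand_comp {α : Type*} [MeasurableSpace α] {μ : Measure α} (p q : ℝ)
    {f g : α → ℝ} (hf : Measure.QuasiMeasurePreserving f μ volume)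
    (hfg : Measure.QuasiMeasurePreserving (fun x => f x + g x) μ volume) :
    AEMeasurable (fun x => γ.tpIntegrand p q (f x, g x)) μ := by
  have h₁ : AEMeasurable (fun x => γ.deriv' (f x)) μ :=
    γ.aemeasurable_deriv'.comp_quasiMeasurePreserving hf
  have h₂ : AEMeasurable (fun x => γ.deriv' (f x + g x)) μ :=
    γ.aemeasurable_deriv'.comp_quasiMeasurePreserving hfg
  have h₃ : AEMeasurable (fun x => γ.toFun (f x + g x) - γ.toFun (f x)) μ :=
    ((γ.continuous_toFun.measurable.comp hfg.measurable).sub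
      (γ.continuous_toFun.measurable.comp hf.measurable)).aemeasurable
  have h₄ : AEMeasurable (fun x =>
      projPerp (γ.deriv' (f x)) (γ.toFun (f x + g x) - γ.toFun (f x))) μ :=
    h₃.sub (((h₁.inner h₃).div (h₁.norm.pow_const 2)).smul h₁)
  exact (((h₄.norm.pow_const q).div (h₃.norm.pow_const p)).mul
    (h₁.norm.mul h₂.norm)).ennreal_ofReal

lemma aemeasurable_tpIntegrand (p q : ℝ) : AEMeasurable (γ.tpIntegrand p q) :=
  γ.aemeasurable_tpIntegrand_comp p q Measure.quasiMeasurePreserving_fst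
    (Measure.quasiMeasurePreserving_fst.comp
      (measurePreserving_add_prod volume volume).quasiMeasurePreserving)

lemma aemeasurable_tpIntegrand_fst (p q w : ℝ) :
    AEMeasurable (fun u => γ.tpIntegrand p q (u, w)) :=
  γ.aemeasurable_tpIntegrand_comp p q (Measure.QuasiMeasurePreserving.id _)
    (measurePreserving_add_right volume w).quasiMeasurePreserving

lemma TP_eq_lintegral_swap (p q : ℝ) :
    TP p q γ = ∫⁻ w in Ioc (0 : ℝ) 1, ∫⁻ u in Ioc (0 : ℝ) 1, γ.tpIntegrand p q (u, w) := by
  refine lintegral_lintegral_swap (f := fun u w => γ.tpIntegrand p q (u, w)) ?_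
  rw [Measure.prod_restrict]
  exact (γ.aemeasurable_tpIntegrand p q).restrict

variable {γ}

lemma IsArclength.ae_norm_add (harc : γ.IsArclength) (w : ℝ) :
    ∀ᵐ u : ℝ, ‖γ.deriv' (u + w)‖ = 1 :=
  (measurePreserving_add_right volume w).quasiMeasurePreserving.ae harc

lemma IsArclength.Gw_le (harc : γ.IsArclength) {p q : ℝ} (hq : 1 ≤ q) (w : ℝ) :
    Gw p q γ w ≤ ENNReal.ofReal (1 / 2) * (∫⁻ u in Ioc (0 : ℝ) 1, γ.tpIntegrand p q (u, w)) +
      ENNReal.ofReal (1 / 2) * (∫⁻ u in Ioc (0 : ℝ) 1, γ.tpIntegrand p q (u, -w)) := by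
  rw [← (γ.tpIntegrand_periodic_fst p q (-w)).setLIntegral_Ioc_comp_add w,
    ← lintegral_const_mul' _ _ ENNReal.ofReal_ne_top,
    ← lintegral_const_mul' _ _ ENNReal.ofReal_ne_top,
    ← lintegral_add_left' ((γ.aemeasurable_tpIntegrand_fst p q w).restrict.const_mul _)]
  refine lintegral_mono_ae (ae_restrict_of_ae ?_)
  filter_upwards [harc, harc.ae_norm_add w] with u ha hb
  have h := gauss_integrand_le (p := p) hq ha hb (x := γ.toFun (u + w) - γ.toFun u)
  rw [← norm_projPerp_neg (γ.deriv' (u + w)), neg_sub] at h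
  rw [tpIntegrand, tpIntegrand, ← ENNReal.ofReal_mul (by norm_num),
    ← ENNReal.ofReal_mul (by norm_num), ← ENNReal.ofReal_add (by positivity) (by positivity)]
  refine ENNReal.ofReal_le_ofReal (h.trans_eq ?_)
  simp only [add_neg_cancel_right, ha, hb, norm_sub_rev (γ.toFun u), mul_one]

lemma IsArclength.G_le_TP (harc : γ.IsArclength) {p q : ℝ} (hq : 1 ≤ q) :
    G p q γ ≤ TP p q γ := by
  set H : ℝ → ℝ≥0∞ := fun w => ∫⁻ u in Ioc (0 : ℝ) 1, γ.tpIntegrand p q (u, w) with hH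
  have hper : Function.Periodic H 1 := fun w =>
    lintegral_congr fun u => γ.tpIntegrand_periodic_snd p q u w
  have hmeas : AEMeasurable H (volume.restrict (Ioc 0 1)) := by
    refine AEMeasurable.lintegral_prod_left' (f := γ.tpIntegrand p q) ?_
    rw [Measure.prod_restrict]
    exact (γ.aemeasurable_tpIntegrand p q).restrict
  calc
    G p q γ ≤ ∫⁻ w in Ioc (0 : ℝ) 1,
        (ENNReal.ofReal (1 / 2) * H w + ENNReal.ofReal (1 / 2) * H (-w)) :=
      lintegral_mono fun w => harc.Gw_le hq w
    _ = TP p q γ := by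
      rw [lintegral_add_left' (hmeas.const_mul _), lintegral_const_mul' _ _ ENNReal.ofReal_ne_top,
        lintegral_const_mul' _ _ ENNReal.ofReal_ne_top, hper.setLIntegral_Ioc_comp_neg, ← add_mul,
        ← ENNReal.ofReal_add (by norm_num) (by norm_num), TP_eq_lintegral_swap]
      norm_num [hH]

end ClosedCurve

lemma HasDerivAt.nonneg_of_monotoneOn_Icc {f : ℝ → ℝ} {f' s t v : ℝ} (hst : s < t)
    (hv : v ∈ Icc s t) (hf : HasDerivAt f f' v) (hmono : MonotoneOn f (Icc s t)) : 0 ≤ f' := by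
  rw [← hf.hasDerivWithinAt.derivWithin (uniqueDiffOn_Icc hst v hv)]
  exact hmono.derivWithin_nonneg

section PlaneCircle

variable {x y : ℝ → ℝ} {r x₀ y₀ : ℝ}

lemma deriv_eq_of_sq_add_sq {x' y' s : ℝ} (hr : 0 < r) (hxy : ∀ v, x v ^ 2 + y v ^ 2 = r ^ 2)
    (hx : HasDerivAt x x' s) (hy : HasDerivAt y y' s) :
    x' = -((x s * y' - y s * x') / r ^ 2 * y s) ∧ y' = (x s * y' - y s * x') / r ^ 2 * x s := by
  have h := (hx.pow 2).add (hy.pow 2)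
  have h0 : x s * x' + y s * y' = 0 := by
    have hc : x ^ 2 + y ^ 2 = fun _ => r ^ 2 := funext hxy
    rw [hc] at h
    have := h.unique (hasDerivAt_const s (r ^ 2))
    norm_num at this
    linarith
  constructor <;> field_simp
  · linear_combination -x' * hxy s + x s * h0
  · linear_combination -y' * hxy s + y s * h0

/-- An injective arc of a planar circle that avoids a point of the circle is traversed in the same
direction at both of its ends. -/
lemma angular_velocity_mul_nonneg {s t x₁ y₁ x₂ y₂ : ℝ} (hr : 0 < r) (hst : s < t)
    (hx : Continuous x) (hy : Continuous y) (hxy : ∀ v, x v ^ 2 + y v ^ 2 = r ^ 2)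
    (h₀ : x₀ ^ 2 + y₀ ^ 2 = r ^ 2) (hne : ∀ v ∈ Icc s t, x v = x₀ → y v ≠ y₀)
    (hinj : ∀ v ∈ Icc s t, ∀ w ∈ Icc s t, x v = x w → y v = y w → v = w)
    (hx₁ : HasDerivAt x x₁ s) (hy₁ : HasDerivAt y y₁ s)
    (hx₂ : HasDerivAt x x₂ t) (hy₂ : HasDerivAt y y₂ t) :
    0 ≤ (x s * y₁ - y s * x₁) * (x t * y₂ - y t * x₂) := by
  set D : ℝ → ℝ := fun v => r ^ 2 - (x v * x₀ + y v * y₀) with hD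
  set N : ℝ → ℝ := fun v => y v * x₀ - x v * y₀ with hN
  have hDpos : ∀ v ∈ Icc s t, 0 < D v := fun v hv => by
    have h2 : 2 * D v = (x v - x₀) ^ 2 + (y v - y₀) ^ 2 := by
      simp only [hD]; linear_combination -h₀ - hxy v
    by_contra! hle
    have h3 : (x v - x₀) ^ 2 = 0 := by nlinarith [sq_nonneg (x v - x₀), sq_nonneg (y v - y₀)]
    have h4 : (y v - y₀) ^ 2 = 0 := by nlinarith [sq_nonneg (x v - x₀), sq_nonneg (y v - y₀)]
    exact hne v hv (sub_eq_zero.1 (pow_eq_zero_iff two_ne_zero |>.1 h3))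
      (sub_eq_zero.1 (pow_eq_zero_iff two_ne_zero |>.1 h4))
  have hND : ∀ v, N v ^ 2 = D v * (2 * r ^ 2 - D v) := fun v => by
    simp only [hD, hN]
    linear_combination (x₀ ^ 2 + y₀ ^ 2) * hxy v + r ^ 2 * h₀
  have hcont : ContinuousOn (fun v => N v / D v) (Icc s t) :=
    ContinuousOn.div (by fun_prop) (by fun_prop) fun v hv => (hDpos v hv).ne'
  have hinjOn : InjOn (fun v => N v / D v) (Icc s t) := fun v hv w hw h => by
    have hv' := hDpos v hv
    have hw' := hDpos w hw
    simp only [div_eq_div_iff hv'.ne' hw'.ne'] at h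
    have h1 : (2 * r ^ 2 - D v) * D w = (2 * r ^ 2 - D w) * D v := by
      have : D v * D w * ((2 * r ^ 2 - D v) * D w - (2 * r ^ 2 - D w) * D v) = 0 := by
        linear_combination -D w ^ 2 * hND v + D v ^ 2 * hND w + (N v * D w + N w * D v) * h
      exact sub_eq_zero.1 ((mul_eq_zero.1 this).resolve_left (by positivity))
    have h2 : D v = D w := by
      have : 2 * r ^ 2 * (D v - D w) = 0 := by linear_combination -h1
      exact sub_eq_zero.1 ((mul_eq_zero.1 this).resolve_left (by positivity))
    have h3 : N v = N w := by
      rw [h2] at h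
      exact mul_right_cancel₀ hw'.ne' h
    simp only [hD, hN] at h2 h3
    have hr2 : r ^ 2 ≠ 0 := by positivity
    refine hinj v hv w hw (mul_left_cancel₀ hr2 ?_) (mul_left_cancel₀ hr2 ?_)
    · linear_combination -(x v - x w) * h₀ - x₀ * h2 - y₀ * h3
    · linear_combination -(y v - y w) * h₀ - y₀ * h2 + x₀ * h3
  have hderiv : ∀ v ∈ Icc s t, ∀ x' y' : ℝ, HasDerivAt x x' v → HasDerivAt y y' v →
      HasDerivAt (fun v => N v / D v) (-(x v * y' - y v * x') / D v) v := by
    intro v hv x' y' hx' hy'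
    have h := ((hy'.mul_const x₀).sub (hx'.mul_const y₀)).div
      (((hx'.mul_const x₀).add (hy'.mul_const y₀)).const_sub (r ^ 2)) (hDpos v hv).ne'
    refine h.congr_deriv ?_
    obtain ⟨h1, h2⟩ := deriv_eq_of_sq_add_sq hr hxy hx' hy'
    set K := x v * y' - y v * x'
    have hDv := (hDpos v hv).ne'
    have hNv := hND v
    change (((y' * x₀ - x' * y₀) * D v) - N v * -(x' * x₀ + y' * y₀)) / D v ^ 2 = _
    have e1 : y' * x₀ - x' * y₀ = K / r ^ 2 * (r ^ 2 - D v) := by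
      simp only [hD]; linear_combination x₀ * h2 - y₀ * h1
    have e2 : x' * x₀ + y' * y₀ = -(K / r ^ 2 * N v) := by
      simp only [hN]; linear_combination x₀ * h1 + y₀ * h2
    rw [e1, e2]
    field_simp
    linear_combination -K * hNv
  have hs := hderiv s (left_mem_Icc.2 hst.le) x₁ y₁ hx₁ hy₁
  have ht := hderiv t (right_mem_Icc.2 hst.le) x₂ y₂ hx₂ hy₂
  have hDs := hDpos s (left_mem_Icc.2 hst.le)
  have hDt := hDpos t (right_mem_Icc.2 hst.le)
  rcases hcont.strictMonoOn_of_injOn_Icc' hst.le hinjOn with hm | hm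
  · have h1 := hs.nonneg_of_monotoneOn_Icc hst (left_mem_Icc.2 hst.le) hm.monotoneOn
    have h2 := ht.nonneg_of_monotoneOn_Icc hst (right_mem_Icc.2 hst.le) hm.monotoneOn
    rw [le_div_iff₀ hDs, zero_mul] at h1
    rw [le_div_iff₀ hDt, zero_mul] at h2
    exact mul_nonneg_of_nonpos_of_nonpos (by linarith) (by linarith)
  · have h1 := hs.neg.nonneg_of_monotoneOn_Icc hst (left_mem_Icc.2 hst.le) hm.antitoneOn.neg
    have h2 := ht.neg.nonneg_of_monotoneOn_Icc hst (right_mem_Icc.2 hst.le) hm.antitoneOn.neg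
    rw [neg_div, neg_neg, le_div_iff₀ hDs, zero_mul] at h1
    rw [neg_div, neg_neg, le_div_iff₀ hDt, zero_mul] at h2
    exact mul_nonneg h1 h2

end PlaneCircle

lemma exists_orthonormal_pair {F : Type*} [NormedAddCommGroup F] [InnerProductSpace ℝ F]
    {V : Submodule ℝ F} (hV : Module.finrank ℝ V = 2) :
    ∃ e₁ e₂ : F, ‖e₁‖ = 1 ∧ ‖e₂‖ = 1 ∧ ⟪e₁, e₂⟫ = 0 ∧
      ∀ v ∈ V, v = ⟪e₁, v⟫ • e₁ + ⟪e₂, v⟫ • e₂ := by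
  have : FiniteDimensional ℝ V := Module.finite_of_finrank_eq_succ hV
  let b := (stdOrthonormalBasis ℝ V).reindex (finCongr hV)
  refine ⟨b 0, b 1, ?_, ?_, ?_, fun v hv => ?_⟩
  · exact b.orthonormal.1 0
  · exact b.orthonormal.1 1
  · exact b.orthonormal.2 (i := 0) (j := 1) (by decide)
  · have h := congrArg (Subtype.val) (b.sum_repr' ⟨v, hv⟩)
    simpa [Fin.sum_univ_two] using h.symm

lemma inner_smul_add_smul {F : Type*} [NormedAddCommGroup F] [InnerProductSpace ℝ F]
    {e₁ e₂ : F} (h₁ : ‖e₁‖ = 1) (h₂ : ‖e₂‖ = 1) (h₁₂ : ⟪e₁, e₂⟫ = 0) (a b c d : ℝ) :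
    ⟪a • e₁ + b • e₂, c • e₁ + d • e₂⟫ = a * c + b * d := by
  simp only [inner_add_left, inner_add_right, real_inner_smul_left, real_inner_smul_right,
    real_inner_self_eq_norm_sq, h₁, h₂, h₁₂, real_inner_comm e₁ e₂]
  ring

namespace ClosedCurve

variable {n : ℕ} {γ : ClosedCurve n}

/-- At two distinct parameters of differentiability of an injective arc-length parametrized circle,
the integrand of the minorant equals the tangent-point integrand. -/
lemma gauss_integrand_eq_of_isCircle {p q s t : ℝ} (hinj : γ.IsInj)
    (hcirc : IsCircle (range γ.toFun)) (hst : s < t) (hts : t < s + 1)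
    (hs : HasDerivAt γ.toFun (γ.deriv' s) s) (ht : HasDerivAt γ.toFun (γ.deriv' t) t)
    (hns : ‖γ.deriv' s‖ = 1) (hnt : ‖γ.deriv' t‖ = 1) :
    (1 / 2 * (‖projPerp (‖γ.toFun t - γ.toFun s‖⁻¹ • (γ.toFun t - γ.toFun s))
        (γ.deriv' t - γ.deriv' s)‖ / ‖γ.toFun t - γ.toFun s‖)) ^ q *
        ‖γ.toFun t - γ.toFun s‖ ^ (2 * q - p) =
      ‖projPerp (γ.deriv' s) (γ.toFun t - γ.toFun s)‖ ^ q / ‖γ.toFun t - γ.toFun s‖ ^ p := by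
  obtain ⟨c, r, V, hr, hV, hS⟩ := hcirc
  obtain ⟨e₁, e₂, he₁, he₂, he, hrepr⟩ := exists_orthonormal_pair hV
  have hin := inner_smul_add_smul he₁ he₂ he
  have hmem : ∀ v, ‖γ.toFun v - c‖ = r ∧ γ.toFun v - c ∈ V := fun v => by
    have : γ.toFun v ∈ range γ.toFun := mem_range_self v
    rwa [hS] at this
  set x : ℝ → ℝ := fun v => ⟪e₁, γ.toFun v - c⟫ with hx
  set y : ℝ → ℝ := fun v => ⟪e₂, γ.toFun v - c⟫ with hy
  have hz : ∀ v, γ.toFun v - c = x v • e₁ + y v • e₂ := fun v => hrepr _ (hmem v).2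
  have hxc : Continuous x := continuous_const.inner (γ.continuous_toFun.sub continuous_const)
  have hyc : Continuous y := continuous_const.inner (γ.continuous_toFun.sub continuous_const)
  have hxy : ∀ v, x v ^ 2 + y v ^ 2 = r ^ 2 := fun v => by
    rw [← (hmem v).1, ← real_inner_self_eq_norm_sq, hz v, hin]
    ring
  have hinj' : ∀ v w, x v = x w → y v = y w → ∃ k : ℤ, v - w = k := fun v w h₁ h₂ => by
    refine hinj v w (sub_left_injective (b := c) ?_)
    simp only [hz, h₁, h₂]
  have hinj₁ : ∀ v w, |v - w| < 1 → x v = x w → y v = y w → v = w := fun v w hvw h₁ h₂ => by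
    obtain ⟨k, hk⟩ := hinj' v w h₁ h₂
    rw [hk] at hvw
    have : k = 0 := Int.abs_lt_one_iff.1 (by exact_mod_cast hvw)
    rw [this, Int.cast_zero] at hk
    exact sub_eq_zero.1 hk
  have hderiv : ∀ v, HasDerivAt γ.toFun (γ.deriv' v) v → ‖γ.deriv' v‖ = 1 →
      ∃ x' y' : ℝ, HasDerivAt x x' v ∧ HasDerivAt y y' v ∧
        γ.deriv' v = x' • e₁ + y' • e₂ ∧ (x v * y' - y v * x') ^ 2 = r ^ 2 := fun v hv hnv => by
    have hx' : HasDerivAt x ⟪e₁, γ.deriv' v⟫ v := by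
      simpa using (hasDerivAt_const v e₁).inner ℝ (hv.sub_const c)
    have hy' : HasDerivAt y ⟪e₂, γ.deriv' v⟫ v := by
      simpa using (hasDerivAt_const v e₂).inner ℝ (hv.sub_const c)
    have hγ' : γ.deriv' v = ⟪e₁, γ.deriv' v⟫ • e₁ + ⟪e₂, γ.deriv' v⟫ • e₂ := by
      refine (hv.sub_const c).unique ?_
      rw [funext hz]
      exact (hx'.smul_const e₁).add (hy'.smul_const e₂)
    refine ⟨_, _, hx', hy', hγ', ?_⟩
    obtain ⟨h1, h2⟩ := deriv_eq_of_sq_add_sq hr hxy hx' hy'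
    have hn : ⟪e₁, γ.deriv' v⟫ ^ 2 + ⟪e₂, γ.deriv' v⟫ ^ 2 = 1 := by
      have := real_inner_self_eq_norm_sq (γ.deriv' v)
      rw [hnv, hγ', hin] at this
      linarith
    set K := x v * ⟪e₂, γ.deriv' v⟫ - y v * ⟪e₁, γ.deriv' v⟫
    rw [h1, h2] at hn
    field_simp at hn
    have h3 : K ^ 2 * r ^ 2 = r ^ 2 * r ^ 2 := by
      rw [← hxy v]
      linear_combination hn - (x v ^ 2 + y v ^ 2 + r ^ 2) * hxy v
    exact mul_right_cancel₀ (by positivity) h3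
  obtain ⟨x₁, y₁, hx₁, hy₁, ha, hK₁⟩ := hderiv s hs hns
  obtain ⟨x₂, y₂, hx₂, hy₂, hb, hK₂⟩ := hderiv t ht hnt
  have hK := angular_velocity_mul_nonneg hr hst hxc hyc hxy (hxy ((s + t - 1) / 2))
    (fun v hv h₁ h₂ => by
      have hv' : |v - (s + t - 1) / 2| < 1 := by
        rw [abs_lt]; constructor <;> linarith [hv.1, hv.2]
      have := hinj₁ _ _ hv' h₁ h₂
      linarith [hv.1])
    (fun v hv w hw => hinj₁ v w (by
      rw [abs_lt]; constructor <;> linarith [hv.1, hv.2, hw.1, hw.2]))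
    hx₁ hy₁ hx₂ hy₂
  obtain ⟨ex₁, ey₁⟩ := deriv_eq_of_sq_add_sq hr hxy hx₁ hy₁
  obtain ⟨ex₂, ey₂⟩ := deriv_eq_of_sq_add_sq hr hxy hx₂ hy₂
  have hKK : x t * y₂ - y t * x₂ = x s * y₁ - y s * x₁ := by
    rcases sq_eq_sq_iff_eq_or_eq_neg.1 (hK₂.trans hK₁.symm) with h | h
    · exact h
    · rw [h] at hK
      nlinarith [pow_pos hr 2]
  rw [hKK] at ex₂ ey₂
  set K := x s * y₁ - y s * x₁
  set k := K / r ^ 2 with hk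
  have hk2 : k ^ 2 * r ^ 2 = 1 := by
    rw [hk, div_pow, hK₁]; field_simp
  have hΔ : γ.toFun t - γ.toFun s = (x t - x s) • e₁ + (y t - y s) • e₂ := by
    rw [← sub_sub_sub_cancel_right _ _ c, hz, hz]
    module
  have hba : γ.deriv' t - γ.deriv' s = (-(k * (y t - y s))) • e₁ + (k * (x t - x s)) • e₂ := by
    rw [ha, hb, ex₁, ex₂, ey₁, ey₂]
    module
  have hΔ2 : ‖γ.toFun t - γ.toFun s‖ ^ 2 = (x t - x s) ^ 2 + (y t - y s) ^ 2 := by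
    rw [← real_inner_self_eq_norm_sq, hΔ, hin]
    ring
  refine gauss_integrand_eq hr (sub_ne_zero.2 fun h => ?_) hns ?_ ?_ ?_
  · have := hinj₁ t s (by rw [abs_lt]; constructor <;> linarith) (by simp only [hx, h])
      (by simp only [hy, h])
    linarith
  · rw [hΔ, hba, hin]
    ring
  · rw [← sq_eq_sq₀ (norm_nonneg _) (by positivity), div_pow, hΔ2, eq_div_iff (by positivity),
      ← real_inner_self_eq_norm_sq, hba, hin]
    linear_combination ((x t - x s) ^ 2 + (y t - y s) ^ 2) * hk2
  · have h₁ : ⟪γ.deriv' s, γ.toFun t - γ.toFun s⟫ = k * (x s * y t - y s * x t) := by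
      rw [hΔ, ha, hin, ex₁, ey₁]
      ring
    have hk' : k ^ 2 = 1 / r ^ 2 := by rw [eq_div_iff (by positivity), hk2]
    have h₂ : (x t - x s) ^ 2 + (y t - y s) ^ 2 = 2 * (r ^ 2 - (x s * x t + y s * y t)) := by
      linear_combination hxy s + hxy t
    have h₃ : (x s * y t - y s * x t) ^ 2 = r ^ 4 - (x s * x t + y s * y t) ^ 2 := by
      linear_combination (x t ^ 2 + y t ^ 2) * hxy s + r ^ 2 * hxy t
    rw [h₁, mul_pow, hk', hΔ2, h₂, h₃]
    field_simp
    ring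

lemma IsArclength.G_eq_TP_of_isCircle (harc : γ.IsArclength) (hinj : γ.IsInj)
    (hcirc : IsCircle (range γ.toFun)) (p q : ℝ) : G p q γ = TP p q γ := by
  rw [TP_eq_lintegral_swap, G, ← restrict_Ioo_eq_restrict_Ioc]
  refine setLIntegral_congr_fun measurableSet_Ioo fun w hw => ?_
  rw [Gw, ← restrict_Ioo_eq_restrict_Ioc]
  refine lintegral_congr_ae (ae_restrict_of_ae ?_)
  have hd : ∀ᵐ u : ℝ, HasDerivAt γ.toFun (γ.deriv' (u + w)) (u + w) :=
    (measurePreserving_add_right volume w).quasiMeasurePreserving.ae γ.ae_hasDerivAt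
  filter_upwards [harc, harc.ae_norm_add w, γ.ae_hasDerivAt, hd] with u hns hnt hs ht
  have h := gauss_integrand_eq_of_isCircle (p := p) (q := q) hinj hcirc
    (lt_add_of_pos_right u hw.1) (by linarith [hw.2]) hs ht hns hnt
  simp only [tpIntegrand, hns, hnt, mul_one, ← h]
  rfl

end ClosedCurve

/-- **`G^{(p,q)}` is a minorant of `TP^{(p,q)}`** (Lemma 5.3): for `q ≥ 1`, `p > 0` and
arc-length parametrized `γ`, `G^{(p,q)}(γ) ≤ TP^{(p,q)}(γ)`, with equality if the image
of `γ` is a circle. -/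
theorem G_le_TP {n : ℕ} (p q : ℝ) (hq : 1 ≤ q) (hp : 0 < p) (γ : ClosedCurve n)
    (hinj : γ.IsInj) (harc : γ.IsArclength) :
    G p q γ ≤ TP p q γ ∧
    (IsCircle (Set.range γ.toFun) → G p q γ = TP p q γ) := by
  exact ⟨harc.G_le_TP hq, fun hcirc => harc.G_eq_TP_of_isCircle hinj hcirc p q⟩

end
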